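/- If f is 2n-times continuously differentiable on [0,∞) and the relevant integrals exist, the error of the n-point Gauss–Laguerre rule satisfies ∫₀^∞ e^(-x) f(x) dx − Σᵢ wᵢ f(xᵢ) = (n!)² f^(2n)(ξ) / (2n)! for some ξ ∈ (0, ∞). -/

import Mathlib

open Polynomial MeasureTheory Real Finset

/-- The `n`th Laguerre polynomial as a polynomial over ℝ
(leading coefficient `(-1)ⁿ/n!`). -/
noncomputable def laguerreP (n : ℕ) : Polynomial ℝ :=
  ∑ k ∈ Finset.range (n + 1),
    Polynomial.C ((-1) ^ k * (n.choose k : ℝ) / (k.factorial : ℝ)) * Polynomial.X ^ k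

lemma gl_pow_int (k : ℕ) : IntegrableOn (fun t : ℝ => Real.exp (-t) * t ^ k) (Set.Ioi 0) := by
  have := Real.GammaIntegral_convergent (s := k + 1) (by positivity)
  simpa using this

lemma gl_pow_val (k : ℕ) : ∫ t in Set.Ioi (0:ℝ), Real.exp (-t) * t ^ k = k.factorial := by
  have := Real.Gamma_eq_integral (s := k + 1) (by positivity)
  rw [Real.Gamma_nat_eq_factorial] at this
  simpa using this.symm

lemma gl_poly_int (p : ℝ[X]) :
    IntegrableOn (fun t : ℝ => Real.exp (-t) * p.eval t) (Set.Ioi 0) := by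
  induction p using Polynomial.induction_on' with
  | add p q hp hq =>
    refine (hp.add hq).congr (Filter.Eventually.of_forall fun t => ?_)
    simp [mul_add]
  | monomial k a =>
    have := (gl_pow_int k).const_mul a
    refine this.congr (Filter.Eventually.of_forall fun t => ?_)
    simp; ring

/-- The Laguerre functional on polynomials. -/
noncomputable def glJ : ℝ[X] →ₗ[ℝ] ℝ where
  toFun p := ∫ t in Set.Ioi (0:ℝ), Real.exp (-t) * p.eval t
  map_add' p q := by
    rw [← integral_add (gl_poly_int p) (gl_poly_int q)]
    simp [mul_add]
  map_smul' a p := by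
    simp only [RingHom.id_apply, smul_eq_mul]
    rw [← integral_const_mul]
    congr 1; ext t; simp; ring

lemma glJ_pow (k : ℕ) : glJ (X ^ k) = k.factorial := by
  have := gl_pow_val k
  simpa [glJ] using this

lemma glJ_lag (n m : ℕ) : glJ (laguerreP n * X ^ m) =
    (-1) ^ n * (fwdDiff (1:ℝ))^[n] ((ascPochhammer ℝ m).comp (X + 1)).eval 0 := by
  rw [fwdDiff_iter_eq_sum_shift, laguerreP, Finset.sum_mul, map_sum, Finset.mul_sum]
  refine Finset.sum_congr rfl fun k hk => ?_
  have hk' : k ≤ n := by simpa [Nat.lt_succ_iff] using hk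
  rw [mul_assoc, ← pow_add, ← smul_eq_C_mul, map_smul, glJ_pow]
  have h1 : ((ascPochhammer ℝ m).comp (X + 1)).eval ((0:ℝ) + k • 1) * k.factorial
      = (k + m).factorial := by
    have : (0:ℝ) + k • 1 + 1 = ((k + 1 : ℕ) : ℝ) := by simp
    rw [eval_comp, eval_add, eval_X, eval_one, this, ascPochhammer_nat_eq_natCast_ascFactorial,
      ← Nat.factorial_mul_ascFactorial]
    push_cast; ring
  have h2 : ((-1:ℝ)) ^ n * (-1) ^ (n - k) = (-1) ^ k := by
    obtain ⟨j, rfl⟩ := Nat.exists_eq_add_of_le hk'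
    rw [Nat.add_sub_cancel_left, pow_add, mul_assoc, ← mul_pow]; simp
  have h3 : (k.factorial : ℝ) ≠ 0 := by positivity
  rw [← h1, smul_eq_mul, zsmul_eq_mul, ← h2]
  push_cast
  field_simp

lemma gl_asc_deg (m : ℕ) : ((ascPochhammer ℝ m).comp (X + 1)).natDegree = m ∧
    ((ascPochhammer ℝ m).comp (X + 1)).leadingCoeff = 1 := by
  have hX : (X + 1 : ℝ[X]).natDegree = 1 := by simpa using natDegree_X_add_C (1:ℝ)
  refine ⟨by rw [natDegree_comp, hX, ascPochhammer_natDegree, mul_one], ?_⟩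
  have := (monic_ascPochhammer (S := ℝ) m).comp (q := X + 1) (by simpa using monic_X_add_C (1:ℝ))
    (by rw [hX]; simp)
  exact this

lemma glJ_lag_lt (n m : ℕ) (h : m < n) : glJ (laguerreP n * X ^ m) = 0 := by
  rw [glJ_lag, Polynomial.fwdDiff_iter_eq_zero_of_degree_lt (by rw [(gl_asc_deg m).1]; exact h)]
  simp

lemma glJ_lag_eq (n : ℕ) : glJ (laguerreP n * X ^ n) = (-1) ^ n * n.factorial := by
  have := Polynomial.fwdDiff_iter_degree_eq_factorial ((ascPochhammer ℝ n).comp (X + 1))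
  rw [(gl_asc_deg n).1, (gl_asc_deg n).2] at this
  rw [glJ_lag, this]; simp

lemma glJ_lag_orth (n : ℕ) (q : ℝ[X]) (hq : q.degree < n) : glJ (laguerreP n * q) = 0 := by
  by_cases h : q = 0
  · simp [h]
  rw [q.as_sum_range' n ((natDegree_lt_iff_degree_lt h).2 hq), Finset.mul_sum, map_sum]
  refine Finset.sum_eq_zero fun i hi => ?_
  rw [← C_mul_X_pow_eq_monomial, mul_left_comm, ← smul_eq_C_mul, map_smul,
    glJ_lag_lt n i (Finset.mem_range.1 hi), smul_zero]

lemma lag_coeff (n : ℕ) : (laguerreP n).coeff n = (-1) ^ n / n.factorial := by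
  simp [laguerreP, coeff_C_mul, coeff_X_pow]

lemma lag_degree_le (n : ℕ) : (laguerreP n).degree ≤ n := by
  refine (degree_sum_le _ _).trans (Finset.sup_le fun k hk => ?_)
  refine (degree_C_mul_X_pow_le _ _).trans ?_
  simpa [Nat.lt_succ_iff] using hk

lemma nodal_eq_lag (n : ℕ) (x : Fin n → ℝ) (hx : Function.Injective x)
    (hroots : ∀ i, (laguerreP n).eval (x i) = 0) :
    Lagrange.nodal Finset.univ x = C ((-1) ^ n * (n.factorial : ℝ)) * laguerreP n := by
  have hc : ((-1) ^ n * (n.factorial : ℝ)) ≠ 0 := by positivity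
  have hL : (laguerreP n).degree = n := by
    refine le_antisymm (lag_degree_le n) (le_degree_of_ne_zero ?_)
    rw [lag_coeff]; positivity
  refine Polynomial.eq_of_degree_le_of_eval_index_eq Finset.univ hx.injOn ?_ ?_ ?_ ?_
  · simp [Lagrange.degree_nodal]
  · rw [degree_C_mul hc, Lagrange.degree_nodal, hL]; simp
  · rw [Lagrange.nodal_monic, leadingCoeff_mul, leadingCoeff_C, leadingCoeff,
      natDegree_eq_of_degree_eq_some hL, lag_coeff]
    field_simp
    rw [← pow_mul, mul_comm, pow_mul]; simp
  · intro i _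
    rw [Lagrange.eval_nodal_at_node (Finset.mem_univ i)]; simp [hroots]

lemma lag_pos (n : ℕ) (t : ℝ) (ht : t ≤ 0) : 0 < (laguerreP n).eval t := by
  rw [laguerreP, eval_finsetSum, Finset.sum_range_succ']
  refine add_pos_of_nonneg_of_pos (Finset.sum_nonneg fun k _ => ?_) (by simp)
  have : eval t (C ((-1) ^ (k+1) * (n.choose (k+1) : ℝ) / ((k+1).factorial : ℝ)) * X ^ (k+1)) =
    (n.choose (k+1) : ℝ) / ((k+1).factorial : ℝ) * (-t) ^ (k+1) := by
    simp only [eval_mul, eval_C, eval_pow, eval_X]; rw [neg_pow t]; ring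
  rw [this]
  have : 0 ≤ -t := by linarith
  positivity

lemma glJ_nodal_sq (n : ℕ) (x : Fin n → ℝ) (hx : Function.Injective x)
    (hroots : ∀ i, (laguerreP n).eval (x i) = 0) :
    glJ (Lagrange.nodal Finset.univ x ^ 2) = (n.factorial : ℝ) ^ 2 := by
  have hd : (Lagrange.nodal Finset.univ x - X ^ n : ℝ[X]).degree < (n : WithBot ℕ) := by
    have h1 : (Lagrange.nodal Finset.univ x).degree = n := by simp [Lagrange.degree_nodal]
    have := degree_sub_lt_left (p := Lagrange.nodal Finset.univ x) (q := X ^ n) (by rw [h1]; simp)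
      Lagrange.nodal_ne_zero (by rw [Lagrange.nodal_monic, leadingCoeff_X_pow])
    rwa [h1] at this
  have h2 : Lagrange.nodal Finset.univ x ^ 2 = ((-1) ^ n * (n.factorial : ℝ)) •
      (laguerreP n * (Lagrange.nodal Finset.univ x - X ^ n) + laguerreP n * X ^ n) := by
    rw [← mul_add, sub_add_cancel, smul_eq_C_mul, ← mul_assoc,
      ← nodal_eq_lag n x hx hroots, sq]
  rw [h2, map_smul, map_add, glJ_lag_orth n _ hd, glJ_lag_eq, zero_add, smul_eq_mul]
  have : ((-1:ℝ) ^ n) * (-1) ^ n = 1 := by rw [← mul_pow]; simp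
  linear_combination (n.factorial : ℝ) ^ 2 * this

/-- Rolle, many points. -/
lemma gl_rolle (g : ℝ → ℝ) (hg : Differentiable ℝ g) (N : ℕ) (S : Finset ℝ) (hS : S.card = N + 1)
    (hpos : ∀ s ∈ S, 0 < s) (h0 : ∀ s ∈ S, g s = 0) :
    ∃ T : Finset ℝ, T.card = N ∧ Disjoint T S ∧ (∀ s ∈ T, 0 < s) ∧ ∀ s ∈ T, deriv g s = 0 := by
  let s := S.orderEmbOfFin hS
  have hmem : ∀ i, s i ∈ S := fun i => S.orderEmbOfFin_mem hS i
  have key : ∀ i : Fin N, ∃ c ∈ Set.Ioo (s i.castSucc) (s i.succ), deriv g c = 0 := fun i =>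
    exists_deriv_eq_zero (s.strictMono Fin.castSucc_lt_succ) hg.continuous.continuousOn
      (by rw [h0 _ (hmem _), h0 _ (hmem _)])
  choose c hc hd using key
  have hmono : StrictMono c := by
    intro i j hij
    refine (hc i).2.trans_le (le_trans (s.monotone ?_) (hc j).1.le)
    rw [Fin.le_def]; exact hij
  refine ⟨Finset.univ.map ⟨c, hmono.injective⟩, by simp, ?_, ?_, ?_⟩
  · rw [Finset.disjoint_left]
    intro a ha haS
    simp only [Finset.mem_map, Finset.mem_univ, true_and, Function.Embedding.coeFn_mk] at ha
    obtain ⟨i, rfl⟩ := ha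
    have : c i ∈ Set.range s := by
      rw [Finset.range_orderEmbOfFin]; exact haS
    obtain ⟨j, hj⟩ := this
    have h1 := (hc i).1; have h2 := (hc i).2
    rw [← hj] at h1 h2
    have h1 := s.lt_iff_lt.1 h1
    have h2 := s.lt_iff_lt.1 h2
    simp [Fin.lt_def] at h1 h2
    omega
  · simp only [Finset.mem_map, Finset.mem_univ, true_and, Function.Embedding.coeFn_mk]
    rintro _ ⟨i, rfl⟩
    exact (hpos _ (hmem _)).trans (hc i).1
  · simp only [Finset.mem_map, Finset.mem_univ, true_and, Function.Embedding.coeFn_mk]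
    rintro _ ⟨i, rfl⟩
    exact hd i

lemma gl_rolle_iter (N : ℕ) : ∀ (g : ℝ → ℝ), ContDiff ℝ N g → ∀ (S : Finset ℝ), S.card = N + 1 →
    (∀ s ∈ S, 0 < s) → (∀ s ∈ S, g s = 0) → ∃ c, 0 < c ∧ iteratedDeriv N g c = 0 := by
  induction N with
  | zero =>
    intro g _ S hS hpos h0
    obtain ⟨a, ha⟩ : S.Nonempty := by rw [← Finset.card_pos]; omega
    exact ⟨a, hpos a ha, by simpa using h0 a ha⟩
  | succ N ih =>
    intro g hg S hS hpos h0
    have hg' : ContDiff ℝ ((N : WithTop ℕ∞) + 1) g := by exact_mod_cast hg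
    obtain ⟨T, hT, -, hTp, hT0⟩ := gl_rolle g (hg'.differentiable (by simp)) (N + 1) S hS hpos h0
    obtain ⟨c, hc, hc0⟩ := ih (deriv g) (contDiff_succ_iff_deriv.1 hg').2.2 T hT hTp hT0
    exact ⟨c, hc, by rw [iteratedDeriv_succ', hc0]⟩

/-- Hermite error. -/
lemma gl_hermite_zero (n : ℕ) (hn : 0 < n) (g : ℝ → ℝ) (hg : ContDiff ℝ (2 * n : ℕ) g)
    (S : Finset ℝ) (hS : S.card = n) (hpos : ∀ s ∈ S, 0 < s) (h0 : ∀ s ∈ S, g s = 0)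
    (h1 : ∀ s ∈ S, deriv g s = 0) (t : ℝ) (ht : 0 < t) (htS : t ∉ S) (hgt : g t = 0) :
    ∃ c, 0 < c ∧ iteratedDeriv (2 * n) g c = 0 := by
  obtain ⟨m, hm⟩ : ∃ m, 2 * n = m + 1 := ⟨2 * n - 1, by omega⟩
  have hg' : ContDiff ℝ ((m : WithTop ℕ∞) + 1) g := by rw [hm] at hg; exact_mod_cast hg
  obtain ⟨T, hT, hTS, hTp, hT0⟩ := gl_rolle g (hg'.differentiable (by simp)) n (insert t S)
    (by rw [Finset.card_insert_of_notMem htS, hS])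
    (by simpa [ht] using hpos) (by simpa [hgt] using h0)
  have hdis : Disjoint T S := hTS.mono_right (Finset.subset_insert t S)
  obtain ⟨c, hc, hc0⟩ := gl_rolle_iter m (deriv g) (contDiff_succ_iff_deriv.1 hg').2.2 (T ∪ S)
    (by rw [Finset.card_union_of_disjoint hdis, hT, hS]; omega)
    (by intro s hs; rcases Finset.mem_union.1 hs with h | h; exacts [hTp s h, hpos s h])
    (by intro s hs; rcases Finset.mem_union.1 hs with h | h; exacts [hT0 s h, h1 s h])
  exact ⟨c, hc, by rw [hm, iteratedDeriv_succ', hc0]⟩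

lemma gl_iter_poly (Q : ℝ[X]) (N : ℕ) (hQ : Q.natDegree ≤ N) (t : ℝ) :
    iteratedDeriv N (fun t => Q.eval t) t = N.factorial * Q.coeff N := by
  have h1 : ∀ N : ℕ, ∀ Q : ℝ[X], iteratedDeriv N (fun t => Q.eval t) =
      fun t => (derivative^[N] Q).eval t := by
    intro N
    induction N with
    | zero => intro Q; simp
    | succ N ih =>
      intro Q
      rw [iteratedDeriv_succ']
      have : deriv (fun t => Q.eval t) = fun t => Q.derivative.eval t := by
        ext t; simp
      rw [this, ih, Function.iterate_succ_apply]
  rw [h1]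
  have h2 : (derivative^[N] Q).natDegree = 0 := by
    have := natDegree_iterate_derivative Q N
    omega
  rw [eq_C_of_natDegree_eq_zero h2]
  simp [coeff_iterate_derivative, Nat.descFactorial_self]

lemma gl_int_pos (h : ℝ → ℝ) (hi : IntegrableOn h (Set.Ioi 0)) (S : Finset ℝ)
    (hp : ∀ t, 0 < t → t ∉ S → 0 < h t) : 0 < ∫ t in Set.Ioi (0:ℝ), h t := by
  have hS : ∀ᵐ t ∂(volume.restrict (Set.Ioi (0:ℝ))), t ∉ S := by
    apply ae_restrict_of_ae
    have := (S.finite_toSet.measure_zero (volume : Measure ℝ))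
    rw [measure_eq_zero_iff_ae_notMem] at this
    simpa using this
  have hae : ∀ᵐ t ∂(volume.restrict (Set.Ioi (0:ℝ))), 0 < h t := by
    filter_upwards [hS, ae_restrict_mem measurableSet_Ioi] with t h1 h2 using hp t h2 h1
  rw [integral_pos_iff_support_of_nonneg_ae (hae.mono fun t ht => ht.le) hi]
  rw [pos_iff_ne_zero]
  intro h0
  rw [measure_eq_zero_iff_ae_notMem] at h0
  have hF : ∀ᵐ t ∂(volume.restrict (Set.Ioi (0:ℝ))), False := by
    filter_upwards [h0, hae] with t h1 h2
    exact h1 (by simpa using h2.ne')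
  rw [Filter.eventually_false_iff_eq_bot, ae_eq_bot] at hF
  have := congrArg (fun μ : Measure ℝ => μ Set.univ) hF
  simp at this

theorem gauss_laguerre_error (n : ℕ) (hn : 0 < n)
    (x : Fin n → ℝ) (hx : Function.Injective x)
    (hroots : ∀ i, (laguerreP n).eval (x i) = 0)
    (w : Fin n → ℝ)
    (hw : ∀ i, w i = ∫ t in Set.Ioi (0:ℝ),
        Real.exp (-t) * (Lagrange.basis Finset.univ x i).eval t)
    (f : ℝ → ℝ) (hf : ContDiff ℝ (2 * n) f)
    (hint : IntegrableOn (fun t => Real.exp (-t) * f t) (Set.Ioi 0)) :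
    ∃ ξ ∈ Set.Ioi (0:ℝ),
      (∫ t in Set.Ioi (0:ℝ), Real.exp (-t) * f t) - ∑ i, w i * f (x i) =
        ((n.factorial : ℝ))^2 * iteratedDeriv (2 * n) f ξ / ((2 * n).factorial : ℝ) := by
  classical
  have hf' : ContDiff ℝ (2 * n : ℕ) f := by exact_mod_cast hf
  have hfd : Differentiable ℝ f := hf'.differentiable (by
    simp only [ne_eq, Nat.cast_eq_zero]; omega)
  have hxpos : ∀ i, 0 < x i := fun i => by
    by_contra h
    exact (lag_pos n (x i) (not_lt.1 h)).ne' (hroots i)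
  set π' := Lagrange.nodal Finset.univ x with hπ
  have hπ0 : ∀ i, π'.eval (x i) = 0 := fun i => Lagrange.eval_nodal_at_node (Finset.mem_univ i)
  have hπd : ∀ i, π'.derivative.eval (x i) ≠ 0 := fun i => by
    rw [hπ, Lagrange.eval_nodal_derivative_eval_node_eq (Finset.mem_univ i)]
    refine Lagrange.eval_nodal_not_at_node fun j hj => ?_
    exact fun h => (Finset.ne_of_mem_erase hj) (hx h).symm
  have hπdeg : π'.natDegree = n := by simp [hπ, Lagrange.natDegree_nodal]
  have hπm : π'.Monic := Lagrange.nodal_monic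
  set p := Lagrange.interpolate Finset.univ x (fun i => f (x i)) with hp
  set q := Lagrange.interpolate Finset.univ x
    (fun i => (deriv f (x i) - p.derivative.eval (x i)) / π'.derivative.eval (x i)) with hq
  have hpv : ∀ i, p.eval (x i) = f (x i) := fun i =>
    Lagrange.eval_interpolate_at_node _ hx.injOn (Finset.mem_univ i)
  have hqv : ∀ i, q.eval (x i) =
      (deriv f (x i) - p.derivative.eval (x i)) / π'.derivative.eval (x i) := fun i =>
    Lagrange.eval_interpolate_at_node _ hx.injOn (Finset.mem_univ i)
  have hpdeg : p.degree < (n : WithBot ℕ) := by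
    simpa [hp] using Lagrange.degree_interpolate_lt (s := Finset.univ) (fun i => f (x i)) hx.injOn
  have hqdeg : q.degree < (n : WithBot ℕ) := by
    simpa [hq] using Lagrange.degree_interpolate_lt (s := Finset.univ)
      (fun i => (deriv f (x i) - p.derivative.eval (x i)) / π'.derivative.eval (x i)) hx.injOn
  set H := p + π' * q with hH
  have hHdeg : H.degree < ((2 * n : ℕ) : WithBot ℕ) := by
    refine (degree_add_le _ _).trans_lt (max_lt (hpdeg.trans_le ?_) ?_)
    · exact_mod_cast (by omega : n ≤ 2 * n)
    · by_cases hq0 : q = 0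
      · rw [hq0, mul_zero, degree_zero]; exact WithBot.bot_lt_coe _
      rw [degree_mul, degree_eq_natDegree hπm.ne_zero, hπdeg, degree_eq_natDegree hq0]
      have := (natDegree_lt_iff_degree_lt hq0).2 hqdeg
      exact_mod_cast (by omega : n + q.natDegree < 2 * n)
  have hHv : ∀ i, H.eval (x i) = f (x i) := fun i => by simp [hH, hπ0, hpv]
  have hHd : ∀ i, H.derivative.eval (x i) = deriv f (x i) := fun i => by
    have := hπd i
    simp [hH, hπ0, hqv]; field_simp; ring
  -- the family of polynomials
  have hdegK : ∀ K : ℝ, (H + C K * π' ^ 2).natDegree ≤ 2 * n := fun K => by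
    refine natDegree_add_le_of_degree_le ?_ ?_
    · exact natDegree_le_of_degree_le hHdeg.le
    · refine (natDegree_C_mul_le _ _).trans ?_
      rw [natDegree_pow, hπdeg]
  have hcoK : ∀ K : ℝ, (H + C K * π' ^ 2).coeff (2 * n) = K := fun K => by
    have h1 : (π' ^ 2).coeff (2 * n) = 1 := by
      have := hπm.pow 2
      rw [Monic, leadingCoeff, natDegree_pow, hπdeg] at this
      exact this
    rw [coeff_add, coeff_C_mul, h1, coeff_eq_zero_of_degree_lt hHdeg]; ring
  have herr : ∀ t, 0 < t → t ∉ Finset.univ.image x → ∃ ξ, 0 < ξ ∧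
      f t - H.eval t = iteratedDeriv (2 * n) f ξ / (2 * n).factorial * (π'.eval t) ^ 2 := by
    intro t ht htS
    have hπt : π'.eval t ≠ 0 := Lagrange.eval_nodal_not_at_node fun j _ h => htS (by
      rw [h]; exact Finset.mem_image_of_mem _ (Finset.mem_univ _))
    set K := (f t - H.eval t) / (π'.eval t) ^ 2 with hK
    set Q := H + C K * π' ^ 2 with hQ
    have hQc : ContDiff ℝ (2 * n : ℕ) (fun t => Q.eval t) := by
      simpa using Q.contDiff_aeval (𝕜 := ℝ) (2 * n : ℕ)
    obtain ⟨ξ, hξ, h0⟩ := gl_hermite_zero n hn (f - fun t => Q.eval t) (hf'.sub hQc)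
      (Finset.univ.image x) (by rw [Finset.card_image_of_injective _ hx]; simp)
      (by simpa using hxpos)
      (by
        intro s hs
        obtain ⟨i, -, rfl⟩ := Finset.mem_image.1 hs
        simp [hQ, hHv, hπ0])
      (by
        intro s hs
        obtain ⟨i, -, rfl⟩ := Finset.mem_image.1 hs
        rw [deriv_sub (hfd _) Q.differentiableAt, Polynomial.deriv]
        simp [hQ, hHd, hπ0, derivative_pow])
      t ht htS (by
        simp only [Pi.sub_apply, hQ, eval_add, eval_mul, eval_C, eval_pow, hK]
        field_simp; ring)
    refine ⟨ξ, hξ, ?_⟩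
    rw [iteratedDeriv_sub hf'.contDiffAt hQc.contDiffAt, gl_iter_poly Q _ (hdegK K), hcoK] at h0
    have h3 : iteratedDeriv (2 * n) f ξ = (2 * n).factorial * K := by linarith
    have h4 : ((2 * n).factorial : ℝ) ≠ 0 := by positivity
    rw [h3, mul_div_cancel_left₀ _ h4, hK]
    field_simp
  -- quadrature
  have hJp : glJ p = ∑ i, w i * f (x i) := by
    rw [hp, Lagrange.interpolate_apply, map_sum]
    refine Finset.sum_congr rfl fun i _ => ?_
    rw [← smul_eq_C_mul, map_smul, hw, smul_eq_mul, mul_comm]; rfl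
  have hJq : glJ (π' * q) = 0 := by
    rw [hπ, nodal_eq_lag n x hx hroots, mul_assoc, ← smul_eq_C_mul, map_smul,
      glJ_lag_orth n q hqdeg, smul_zero]
  set E := (∫ t in Set.Ioi (0:ℝ), Real.exp (-t) * f t) - ∑ i, w i * f (x i) with hE
  have hfac : (n.factorial : ℝ) ≠ 0 := by positivity
  have hfac2 : (0:ℝ) < ((2 * n).factorial : ℝ) := by positivity
  set c := E / (n.factorial : ℝ) ^ 2 with hc
  set P := H + C c * π' ^ 2 with hP
  have hJP : glJ P = ∫ t in Set.Ioi (0:ℝ), Real.exp (-t) * f t := by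
    rw [hP, hH, map_add, map_add, hJp, hJq, ← smul_eq_C_mul, map_smul, hπ,
      glJ_nodal_sq n x hx hroots, hc, smul_eq_mul, div_mul_cancel₀ _ (pow_ne_zero 2 hfac), hE]
    ring
  have hzero : ∫ t in Set.Ioi (0:ℝ), (Real.exp (-t) * f t - Real.exp (-t) * P.eval t) = 0 := by
    rw [integral_sub hint (gl_poly_int P), ← hJP]
    exact sub_self _
  have hI := hint.sub (gl_poly_int P)
  by_contra hcon
  push Not at hcon
  have hne : ∀ ξ, 0 < ξ → iteratedDeriv (2 * n) f ξ ≠ (2 * n).factorial * c := by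
    intro ξ hξ h
    apply hcon ξ hξ
    rw [h, hc]; field_simp
  have hcont : Continuous (iteratedDeriv (2 * n) f) := hf'.continuous_iteratedDeriv _ le_rfl
  have hposπ : ∀ t, t ∉ Finset.univ.image x → 0 < (π'.eval t) ^ 2 := fun t htS => by
    have : π'.eval t ≠ 0 := Lagrange.eval_nodal_not_at_node fun j _ h => htS (by
      rw [h]; exact Finset.mem_image_of_mem _ (Finset.mem_univ _))
    positivity
  have hrep : ∀ t, 0 < t → t ∉ Finset.univ.image x → ∃ ξ, 0 < ξ ∧
      Real.exp (-t) * f t - Real.exp (-t) * P.eval t = Real.exp (-t) *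
        ((iteratedDeriv (2 * n) f ξ / (2 * n).factorial - c) * (π'.eval t) ^ 2) := by
    intro t ht htS
    obtain ⟨ξ, hξ, h⟩ := herr t ht htS
    refine ⟨ξ, hξ, ?_⟩
    simp only [hP, eval_add, eval_mul, eval_C, eval_pow]
    linear_combination Real.exp (-t) * h
  have hdich : (∀ ξ, 0 < ξ → (2 * n).factorial * c < iteratedDeriv (2 * n) f ξ) ∨
      (∀ ξ, 0 < ξ → iteratedDeriv (2 * n) f ξ < (2 * n).factorial * c) := by
    by_contra hh
    push Not at hh
    obtain ⟨⟨a, ha, ha'⟩, ⟨b, hb, hb'⟩⟩ := hh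
    obtain ⟨ξ, hξ, h⟩ := (isPreconnected_Ioi (a := (0:ℝ))).intermediate_value
      (show a ∈ Set.Ioi (0:ℝ) from ha) (show b ∈ Set.Ioi (0:ℝ) from hb)
      hcont.continuousOn ⟨ha', hb'⟩
    exact hne ξ hξ h
  rcases hdich with hd | hd
  · have := gl_int_pos _ hI (Finset.univ.image x) (fun t ht htS => by
      obtain ⟨ξ, hξ, h⟩ := hrep t ht htS
      simp only [Pi.sub_apply]
      rw [h]
      have h1 := hposπ t htS
      have h2 : 0 < iteratedDeriv (2 * n) f ξ / (2 * n).factorial - c := by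
        rw [sub_pos, lt_div_iff₀ hfac2]; linarith [hd ξ hξ]
      positivity)
    exact this.ne' hzero
  · have := gl_int_pos _ hI.neg (Finset.univ.image x) (fun t ht htS => by
      obtain ⟨ξ, hξ, h⟩ := hrep t ht htS
      simp only [Pi.sub_apply, Pi.neg_apply]
      rw [h]
      have h1 := hposπ t htS
      have h2 : 0 < c - iteratedDeriv (2 * n) f ξ / (2 * n).factorial := by
        rw [sub_pos, div_lt_iff₀ hfac2]; linarith [hd ξ hξ]
      have h3 := mul_pos (Real.exp_pos (-t)) (mul_pos h2 h1)
      linarith)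
    simp only [Pi.neg_apply, Pi.sub_apply, integral_neg] at this
    linarith
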